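/- Theorem (Connes). Let A be a unital associative algebra over ℂ. The map sending a cyclic cochain φ ∈ C_λ^n(A) to the element of Tot^n 𝓑(A) = C^n(A) ⊕ C^{n−2}(A) ⊕ C^{n−4}(A) ⊕ ⋯ whose C^n(A)-component is φ and whose other components are zero is a quasi-isomorphism of cochain complexes from the cyclic complex (C_λ^*(A), b) to the total complex (Tot 𝓑(A), b + B); that is, it is a chain map inducing an isomorphism on cohomology in every degree. -/

import Mathlib

noncomputable section
namespace NCG

abbrev Cochain (A : Type) (n : ℕ) : Type := (Fin (n + 1) → A) → ℂ

variable {A : Type} [Ring A] [Algebra ℂ A]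

def face {n : ℕ} (a : Fin (n + 2) → A) (i : Fin (n + 1)) : Fin (n + 1) → A :=
  fun j => if j < i then a j.castSucc else if j = i then a j.castSucc * a j.succ else a j.succ

def cyclicFace {n : ℕ} (a : Fin (n + 2) → A) : Fin (n + 1) → A :=
  fun j => if j = 0 then a (Fin.last (n + 1)) * a 0 else a j.castSucc

def bP {n : ℕ} (φ : Cochain A n) : Cochain A (n + 1) :=
  fun a => ∑ i : Fin (n + 1), (-1 : ℂ) ^ (i : ℕ) * φ (face a i)

def bH {n : ℕ} (φ : Cochain A n) : Cochain A (n + 1) :=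
  fun a => bP φ a + (-1 : ℂ) ^ (n + 1) * φ (cyclicFace a)

def lam {n : ℕ} (φ : Cochain A n) : Cochain A n :=
  fun a => (-1 : ℂ) ^ n * φ (fun j => a (j - 1))

def opN {n : ℕ} (φ : Cochain A n) : Cochain A n :=
  fun a => ∑ k ∈ Finset.range (n + 1), (lam^[k] φ) a

def opS {n : ℕ} (φ : Cochain A (n + 1)) : Cochain A n :=
  fun a => (-1 : ℂ) ^ n * φ (Fin.snoc a 1)

def opB0 {n : ℕ} (φ : Cochain A (n + 1)) : Cochain A n :=
  fun a => φ (Fin.cons 1 a) - (-1 : ℂ) ^ (n + 1) * φ (Fin.snoc a 1)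

def opB {n : ℕ} (φ : Cochain A (n + 1)) : Cochain A n := opN (opB0 φ)

def IsML {n : ℕ} (φ : Cochain A n) : Prop :=
  ∃ F : MultilinearMap ℂ (fun _ : Fin (n + 1) => A) ℂ, ⇑F = φ

/-- Total differential `b + B` of Connes' `(b,B)`-bicomplex `𝓑(A)`, acting on
families indexed by cochain degree. -/
def totD (x : ∀ m : ℕ, Cochain A m) : ∀ m : ℕ, Cochain A m
  | 0 => opB (x 1)
  | m + 1 => bH (x m) + opB (x (m + 2))

/-- The family concentrated in degree `n`, namely `(0, …, 0, φ)`. -/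
def inclT (n : ℕ) (φ : Cochain A n) : ∀ m : ℕ, Cochain A m :=
  fun m => if h : m = n then cast (by rw [h]) φ else 0

/-- Membership in `Totᴺ 𝓑(A) = ⊕_{i ≥ 0} C^{N-2i}(A)`: the components of degree
`> N` or of the wrong parity vanish. -/
def InTot (N : ℤ) (x : ∀ m : ℕ, Cochain A m) : Prop :=
  ∀ m : ℕ, x m ≠ 0 → ((m : ℤ) ≤ N ∧ (m : ℤ) % 2 = N % 2)

/-- Every member of the family is a multilinear cochain. -/
def MLFam (x : ∀ m : ℕ, Cochain A m) : Prop := ∀ m : ℕ, IsML (x m)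

set_option linter.unusedSectionVars false

theorem sum_alternating_eq_zero (N : ℕ) (f : ℕ → ℕ → ℂ)
    (hf : ∀ i j, i < j → j ≤ N → f i j = f (j - 1) i) :
    ∑ j ∈ Finset.range (N + 1), (-1 : ℂ) ^ j * ∑ i ∈ Finset.range N, (-1 : ℂ) ^ i * f i j = 0 := by
  induction N with
  | zero => simp
  | succ N ih =>
    have h := ih fun i j hij hj => hf i j hij (by omega)
    rw [Finset.sum_range_succ]
    simp only [Finset.sum_range_succ _ N, mul_add, Finset.sum_add_distrib] at h ⊢
    rw [Finset.sum_congr rfl fun i (hi : i ∈ Finset.range N) =>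
      show (-1 : ℂ) ^ i * f i (N + 1) = (-1) ^ i * f N i by
        rw [hf i (N + 1) (by simp at hi; omega) le_rfl, Nat.add_sub_cancel],
      hf N (N + 1) (by omega) le_rfl]
    have h' : ∑ j ∈ Finset.range N, (-1 : ℂ) ^ j * ((-1) ^ N * f N j) =
        (-1) ^ N * ∑ j ∈ Finset.range N, (-1 : ℂ) ^ j * f N j := by
      rw [Finset.mul_sum]
      exact Finset.sum_congr rfl fun _ _ => by ring
    rw [h']
    simp only [Nat.add_sub_cancel, pow_succ]
    linear_combination h

/-- The `i`-th Hochschild face, the cyclic one being the last. -/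
def nface {n : ℕ} (i : ℕ) (a : Fin (n + 2) → A) : Fin (n + 1) → A :=
  if h : i < n + 1 then face a ⟨i, h⟩ else cyclicFace a

theorem nface_mk {n : ℕ} (i : ℕ) (a : Fin (n + 2) → A) (k : ℕ) (hk : k < n + 1) :
    nface i a ⟨k, hk⟩ =
      if i ≤ n then
        if k < i then a ⟨k, by omega⟩
        else if k = i then a ⟨k, by omega⟩ * a ⟨k + 1, by omega⟩ else a ⟨k + 1, by omega⟩
      else if k = 0 then a ⟨n + 1, by omega⟩ * a ⟨0, by omega⟩ else a ⟨k, by omega⟩ := by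
  simp only [nface, Nat.lt_succ_iff]
  split_ifs <;> simp_all [face, cyclicFace, Fin.last]

theorem exists_nat_extension {n : ℕ} (a : Fin n → A) :
    ∃ f : ℕ → A, ∀ k hk, a ⟨k, hk⟩ = f k :=
  ⟨fun k => if h : k < n then a ⟨k, h⟩ else 0, fun k hk => by simp [hk]⟩

theorem nface_nface {n : ℕ} (a : Fin (n + 3) → A) {i j : ℕ} (hij : i < j) (hj : j ≤ n + 2) :
    nface i (nface j a) = nface (j - 1) (nface i a) := by
  obtain ⟨f, hf⟩ := exists_nat_extension a
  funext ⟨k, hk⟩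
  simp only [nface_mk, hf]
  grind

theorem bP_apply {n : ℕ} (φ : Cochain A n) (a : Fin (n + 2) → A) :
    bP φ a = ∑ i ∈ Finset.range (n + 1), (-1 : ℂ) ^ i * φ (nface i a) := by
  rw [bP, Finset.sum_range]
  exact Finset.sum_congr rfl fun i _ => by rw [nface, dif_pos i.2]

theorem bH_apply {n : ℕ} (φ : Cochain A n) (a : Fin (n + 2) → A) :
    bH φ a = ∑ i ∈ Finset.range (n + 2), (-1 : ℂ) ^ i * φ (nface i a) := by
  rw [Finset.sum_range_succ, ← bP_apply]
  simp [bH, nface]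

theorem bP_bP {n : ℕ} (φ : Cochain A n) : bP (bP φ) = 0 := by
  funext a
  simp only [bP_apply]
  exact sum_alternating_eq_zero _ (fun i j => φ (nface i (nface j a))) fun i j hij hj => by
    simp only [nface_nface a hij (by omega)]

theorem bH_bH {n : ℕ} (φ : Cochain A n) : bH (bH φ) = 0 := by
  funext a
  simp only [bH_apply]
  exact sum_alternating_eq_zero _ (fun i j => φ (nface i (nface j a))) fun i j hij hj => by
    simp only [nface_nface a hij hj]

/-- Cyclic rotation of the arguments. -/
def rot {n : ℕ} (a : Fin (n + 1) → A) : Fin (n + 1) → A := fun j => a (j - 1)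

theorem rot_mk {n : ℕ} (a : Fin (n + 1) → A) (k : ℕ) (h : k < n + 1) :
    rot a ⟨k, h⟩ = if k = 0 then a ⟨n, by omega⟩ else a ⟨k - 1, by omega⟩ := by
  have : ((⟨k, h⟩ - 1 : Fin (n + 1)) : ℕ) = if k = 0 then n else k - 1 := by
    rw [Fin.coe_sub_one]
    simp [Fin.ext_iff]
  unfold rot
  split_ifs with hk <;> congr 1 <;> ext <;> simp [this, hk]

theorem nface_zero_rot {n : ℕ} (a : Fin (n + 2) → A) : nface 0 (rot a) = nface (n + 1) a := by
  obtain ⟨f, hf⟩ := exists_nat_extension a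
  funext ⟨k, hk⟩
  simp only [nface_mk, rot_mk, hf]
  grind

theorem nface_succ_rot {n : ℕ} (a : Fin (n + 2) → A) {i : ℕ} (hi : i ≤ n) :
    nface (i + 1) (rot a) = rot (nface i a) := by
  obtain ⟨f, hf⟩ := exists_nat_extension a
  funext ⟨k, hk⟩
  simp only [nface_mk, rot_mk, hf]
  grind

theorem iterate_rot {n : ℕ} (a : Fin (n + 1) → A) (k : ℕ) :
    rot^[k] a = fun j => a (j - k • 1) := by
  induction k with
  | zero => simp
  | succ k ih =>
    rw [Function.iterate_succ_apply', ih]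
    funext j
    simp only [rot, succ_nsmul', sub_sub]

theorem iterate_rot_eq {n : ℕ} (a : Fin (n + 1) → A) : rot^[n + 1] a = a := by
  have h : (n + 1) • (1 : Fin (n + 1)) = 0 := by
    simpa using card_nsmul_eq_zero' (x := (1 : Fin (n + 1)))
  rw [iterate_rot, h]
  simp

theorem lam_apply {n : ℕ} (φ : Cochain A n) (a : Fin (n + 1) → A) :
    lam φ a = (-1 : ℂ) ^ n * φ (rot a) := rfl

theorem iterate_lam_apply {n : ℕ} (φ : Cochain A n) (k : ℕ) (a : Fin (n + 1) → A) :
    lam^[k] φ a = (-1 : ℂ) ^ (n * k) * φ (rot^[k] a) := by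
  induction k generalizing a with
  | zero => simp
  | succ k ih =>
    rw [Function.iterate_succ_apply', lam_apply, ih, ← Function.iterate_succ_apply]
    ring

theorem iterate_lam_eq {n : ℕ} (φ : Cochain A n) : lam^[n + 1] φ = φ := by
  funext a
  rw [iterate_lam_apply, iterate_rot_eq, (Nat.even_mul_succ_self n).neg_one_pow, one_mul]

/-- The cyclic operator as a linear map. -/
def lamL (n : ℕ) : Module.End ℂ (Cochain A n) where
  toFun := lam
  map_add' φ ψ := by funext a; simp [lam]; ring
  map_smul' c φ := by funext a; simp [lam]; ring

/-- The operator `1 - λ`. -/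
def dL (n : ℕ) : Module.End ℂ (Cochain A n) := 1 - lamL n

/-- The norm operator `1 + λ + ⋯ + λⁿ`. -/
def NL (n : ℕ) : Module.End ℂ (Cochain A n) := ∑ k ∈ Finset.range (n + 1), lamL n ^ k

/-- The operator `b'` as a linear map. -/
def bPL (n : ℕ) : Cochain A n →ₗ[ℂ] Cochain A (n + 1) where
  toFun := bP
  map_add' φ ψ := by funext a; simp [bP, mul_add, Finset.sum_add_distrib]
  map_smul' c φ := by funext a; simp [bP, Finset.mul_sum, mul_left_comm]

/-- The Hochschild differential as a linear map. -/
def bHL (n : ℕ) : Cochain A n →ₗ[ℂ] Cochain A (n + 1) where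
  toFun := bH
  map_add' φ ψ := by
    funext a
    simp only [bH_apply, Pi.add_apply, mul_add, Finset.sum_add_distrib]
  map_smul' c φ := by
    funext a
    simp only [bH_apply, Pi.smul_apply, smul_eq_mul, Finset.mul_sum, mul_left_comm,
      RingHom.id_apply]

/-- The contracting homotopy of `b'` as a linear map. -/
def SL (n : ℕ) : Cochain A (n + 1) →ₗ[ℂ] Cochain A n where
  toFun := opS
  map_add' φ ψ := by funext a; simp [opS]; ring
  map_smul' c φ := by funext a; simp [opS]; ring

theorem lamL_pow_apply {n : ℕ} (k : ℕ) (φ : Cochain A n) : (lamL n ^ k) φ = lam^[k] φ :=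
  Module.End.pow_apply _ _ _

theorem lamL_pow_eq_one (n : ℕ) : (lamL n : Module.End ℂ (Cochain A n)) ^ (n + 1) = 1 :=
  LinearMap.ext fun φ => (lamL_pow_apply _ φ).trans (iterate_lam_eq φ)

theorem dL_apply {n : ℕ} (φ : Cochain A n) : dL n φ = φ - lam φ := rfl

theorem dL_eq_zero_iff {n : ℕ} {φ : Cochain A n} : dL n φ = 0 ↔ lam φ = φ := by
  rw [dL_apply, sub_eq_zero, eq_comm]

theorem opN_eq {n : ℕ} (φ : Cochain A n) : opN φ = NL n φ := by
  funext a
  simp [opN, NL, LinearMap.sum_apply, lamL_pow_apply]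

theorem opB_eq {n : ℕ} (φ : Cochain A (n + 1)) : opB φ = NL n (SL n (dL (n + 1) φ)) := by
  rw [opB, opN_eq]
  congr 1
  funext a
  have h : rot (Fin.snoc a 1 : Fin (n + 2) → A) = Fin.cons 1 a := by
    funext ⟨k, hk⟩
    rcases k with _ | k
    · rw [rot_mk]
      simp [Fin.snoc]
    · rw [rot_mk]
      have hk' : k < n + 1 := by omega
      simp only [Fin.snoc, Nat.add_one_ne_zero, if_false, Nat.add_sub_cancel, hk', dif_pos]
      rfl
  change _ = (-1 : ℂ) ^ n * (φ - lam φ) (Fin.snoc a 1)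
  simp only [opB0, Pi.sub_apply, lam_apply, h, pow_succ]
  have h2 : ((-1 : ℂ) ^ n) * (-1) ^ n = 1 := by rw [← mul_pow]; simp
  linear_combination (-φ (Fin.cons 1 a)) * h2

theorem dL_NL {n : ℕ} (φ : Cochain A n) : dL n (NL n φ) = 0 := by
  have := mul_neg_geom_sum (lamL n : Module.End ℂ (Cochain A n)) (n + 1)
  rw [lamL_pow_eq_one, sub_self] at this
  exact LinearMap.congr_fun this φ

theorem NL_dL {n : ℕ} (φ : Cochain A n) : NL n (dL n φ) = 0 := by
  have := geom_sum_mul_neg (lamL n : Module.End ℂ (Cochain A n)) (n + 1)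
  rw [lamL_pow_eq_one, sub_self] at this
  exact LinearMap.congr_fun this φ

theorem NL_lam {n : ℕ} (φ : Cochain A n) : NL n (lam φ) = NL n φ := by
  have := NL_dL φ
  rw [dL_apply, map_sub, sub_eq_zero] at this
  exact this.symm

theorem NL_of_dL_eq_zero {n : ℕ} {φ : Cochain A n} (h : dL n φ = 0) :
    NL n φ = ((n : ℂ) + 1) • φ := by
  have hk : ∀ k, lam^[k] φ = φ := fun k => Function.iterate_fixed (dL_eq_zero_iff.1 h) k
  rw [NL, LinearMap.sum_apply, Finset.sum_congr rfl fun k _ => (lamL_pow_apply k φ).trans (hk k),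
    Finset.sum_const, Finset.card_range, ← Nat.cast_smul_eq_nsmul ℂ]
  push_cast
  rfl

/-- A homotopy inverse of `1 - λ` on the kernel of the norm operator. -/
def theta (n : ℕ) : Module.End ℂ (Cochain A n) :=
  ((n : ℂ) + 1)⁻¹ • ∑ k ∈ Finset.range (n + 1), ∑ j ∈ Finset.range k, lamL n ^ j

theorem dL_theta {n : ℕ} {φ : Cochain A n} (h : NL n φ = 0) : dL n (theta n φ) = φ := by
  have hn : (n : ℂ) + 1 ≠ 0 := Nat.cast_add_one_ne_zero n
  have h1 : dL n * theta n = 1 - ((n : ℂ) + 1)⁻¹ • (NL n : Module.End ℂ (Cochain A n)) := by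
    rw [theta, mul_smul_comm, Finset.mul_sum]
    simp only [dL, mul_neg_geom_sum]
    rw [Finset.sum_sub_distrib, ← NL, Finset.sum_const, Finset.card_range,
      ← Nat.cast_smul_eq_nsmul ℂ, smul_sub, smul_smul]
    push_cast
    rw [inv_mul_cancel₀ hn, one_smul]
  have h2 := LinearMap.congr_fun h1 φ
  simpa [h] using h2

theorem NL_inv_smul {n : ℕ} {φ : Cochain A n} (h : dL n φ = 0) :
    NL n (((n : ℂ) + 1)⁻¹ • φ) = φ := by
  rw [map_smul, NL_of_dL_eq_zero h, inv_smul_smul₀ (Nat.cast_add_one_ne_zero n)]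

/-- The signed `i`-th coface. -/
def coface {n : ℕ} (i : ℕ) (φ : Cochain A n) : Cochain A (n + 1) :=
  fun a => (-1 : ℂ) ^ i * φ (nface i a)

theorem bPL_eq_sum {n : ℕ} (φ : Cochain A n) :
    bPL n φ = ∑ i ∈ Finset.range (n + 1), coface i φ := by
  funext a
  rw [Finset.sum_apply]
  exact bP_apply φ a

theorem bHL_eq_sum {n : ℕ} (φ : Cochain A n) :
    bHL n φ = ∑ i ∈ Finset.range (n + 2), coface i φ := by
  funext a
  rw [Finset.sum_apply]
  exact bH_apply φ a

theorem lam_coface_zero {n : ℕ} (φ : Cochain A n) : lam (coface 0 φ) = coface (n + 1) φ := by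
  funext a
  simp [lam_apply, coface, nface_zero_rot]

theorem lam_coface_succ {n : ℕ} (φ : Cochain A n) {i : ℕ} (hi : i ≤ n) :
    lam (coface (i + 1) φ) = coface i (lam φ) := by
  funext a
  simp only [lam_apply, coface, nface_succ_rot a hi]
  ring

theorem dL_bHL {n : ℕ} (φ : Cochain A n) : dL (n + 1) (bHL n φ) = bPL n (dL n φ) := by
  rw [dL_apply, dL_apply, map_sub]
  change _ - lamL _ _ = _
  have h : lamL (n + 1) (bHL n φ) = coface (n + 1) φ + bPL n (lam φ) := by
    rw [bHL_eq_sum, map_sum, Finset.sum_range_succ', bPL_eq_sum, add_comm (coface (n + 1) φ)]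
    refine congrArg₂ _ ?_ (lam_coface_zero φ)
    exact Finset.sum_congr rfl fun i hi => lam_coface_succ φ (by simp at hi; omega)
  rw [h, bHL_eq_sum, Finset.sum_range_succ, ← bPL_eq_sum]
  abel

theorem NL_coface {n : ℕ} (φ : Cochain A n) {i : ℕ} (hi : i ≤ n + 1) :
    NL (n + 1) (coface i φ) = NL (n + 1) (coface 0 (lam^[i] φ)) := by
  induction i generalizing φ with
  | zero => rfl
  | succ i ih =>
    rw [← NL_lam, lam_coface_succ φ (by omega), ih _ (by omega), ← Function.iterate_succ_apply]

theorem NL_bPL {n : ℕ} (φ : Cochain A n) : NL (n + 1) (bPL n φ) = bHL n (NL n φ) := by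
  have hcyc : dL n (NL n φ) = 0 := dL_NL φ
  have h1 : NL (n + 1) (bPL n φ) = NL (n + 1) (coface 0 (NL n φ)) := by
    have : coface 0 (NL n φ) = ∑ i ∈ Finset.range (n + 1), coface 0 (lam^[i] φ) := by
      funext a
      simp [coface, NL, LinearMap.sum_apply, lamL_pow_apply]
    rw [this, bPL_eq_sum, map_sum, map_sum]
    exact Finset.sum_congr rfl fun i hi => NL_coface φ (by simp at hi; omega)
  have h2 : dL (n + 1) (bHL n (NL n φ)) = 0 := by rw [dL_bHL, hcyc, map_zero]
  have h3 : NL (n + 1) (bHL n (NL n φ)) =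
      (((n + 1 : ℕ) : ℂ) + 1) • NL (n + 1) (coface 0 (NL n φ)) := by
    rw [bHL_eq_sum, map_sum, Finset.sum_congr rfl fun i (hi : i ∈ Finset.range (n + 2)) => by
      rw [NL_coface _ (by simp at hi; omega), Function.iterate_fixed (dL_eq_zero_iff.1 hcyc)],
      Finset.sum_const, Finset.card_range, ← Nat.cast_smul_eq_nsmul ℂ]
    push_cast
    ring_nf
  rw [NL_of_dL_eq_zero h2] at h3
  rw [h1]
  exact (smul_right_injective _ (Nat.cast_add_one_ne_zero (n + 1)) h3).symm

theorem bPL_bPL {n : ℕ} (φ : Cochain A n) : bPL (n + 1) (bPL n φ) = 0 := bP_bP φ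

theorem bHL_bHL {n : ℕ} (φ : Cochain A n) : bHL (n + 1) (bHL n φ) = 0 := bH_bH φ

theorem nface_snoc_of_lt {n : ℕ} (a : Fin (n + 2) → A) {i : ℕ} (hi : i ≤ n) :
    nface i (Fin.snoc a 1 : Fin (n + 3) → A) = Fin.snoc (nface i a) 1 := by
  obtain ⟨f, hf⟩ := exists_nat_extension a
  funext ⟨k, hk⟩
  simp only [nface_mk, Fin.snoc, Fin.castLT, cast_eq, hf]
  grind

theorem nface_snoc_last {n : ℕ} (a : Fin (n + 1) → A) :
    nface n (Fin.snoc a 1 : Fin (n + 2) → A) = a := by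
  obtain ⟨f, hf⟩ := exists_nat_extension a
  funext ⟨k, hk⟩
  simp only [nface_mk, Fin.snoc, Fin.castLT, cast_eq, hf]
  grind

theorem SL_bPL_zero (φ : Cochain A 0) : SL 0 (bPL 0 φ) = φ := by
  funext a
  change (-1 : ℂ) ^ 0 * bP φ (Fin.snoc a 1) = φ a
  rw [bP_apply]
  simp [nface_snoc_last]

theorem SL_bPL_add {n : ℕ} (φ : Cochain A (n + 1)) :
    SL (n + 1) (bPL (n + 1) φ) + bPL n (SL n φ) = φ := by
  funext a
  change (-1 : ℂ) ^ (n + 1) * bP φ (Fin.snoc a 1) + bP (opS φ) a = φ a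
  rw [bP_apply, bP_apply, Finset.sum_range_succ, nface_snoc_last, Finset.sum_congr rfl
    fun i (hi : i ∈ Finset.range (n + 1)) => by rw [nface_snoc_of_lt a (by simp at hi; omega)]]
  have h : ∑ i ∈ Finset.range (n + 1), (-1 : ℂ) ^ i * opS φ (nface i a) =
      (-1 : ℂ) ^ n * ∑ i ∈ Finset.range (n + 1), (-1 : ℂ) ^ i * φ (Fin.snoc (nface i a) 1) := by
    rw [Finset.mul_sum]
    exact Finset.sum_congr rfl fun i _ => by rw [opS]; ring
  have h2 : ((-1 : ℂ) ^ n) * (-1) ^ n = 1 := by rw [← mul_pow]; simp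
  rw [h, pow_succ]
  linear_combination φ a * h2

theorem isML_iff {n : ℕ} {φ : Cochain A n} :
    IsML φ ↔ (∀ a i x y, φ (Function.update a i (x + y)) =
        φ (Function.update a i x) + φ (Function.update a i y)) ∧
      ∀ a i (c : ℂ) x, φ (Function.update a i (c • x)) = c • φ (Function.update a i x) := by
  constructor
  · rintro ⟨F, rfl⟩
    exact ⟨F.map_update_add, F.map_update_smul⟩
  · rintro ⟨hadd, hsmul⟩
    exact ⟨MultilinearMap.mk' φ hadd hsmul, rfl⟩

theorem IsML.comp {n m : ℕ} {φ : Cochain A n} (hφ : IsML φ)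
    (g : (Fin (m + 1) → A) → Fin (n + 1) → A)
    (hg : ∀ a k, ∃ (j : Fin (n + 1)) (l : A →ₗ[ℂ] A), ∀ x,
      g (Function.update a k x) = Function.update (g a) j (l x)) :
    IsML (fun a => φ (g a) : Cochain A m) := by
  obtain ⟨hadd, hsmul⟩ := isML_iff.1 hφ
  refine isML_iff.2 ⟨fun a k x y => ?_, fun a k c x => ?_⟩ <;>
    obtain ⟨j, l, h⟩ := hg a k
  · simp only [h, map_add, hadd]
  · simp only [h, map_smul, hsmul]

/-- The subspace of multilinear cochains. -/
def multilinearCochains (A : Type) [Ring A] [Algebra ℂ A] (n : ℕ) : Submodule ℂ (Cochain A n) where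
  carrier := {φ | IsML φ}
  zero_mem' := ⟨0, rfl⟩
  add_mem' := by
    rintro _ _ ⟨F, rfl⟩ ⟨G, rfl⟩
    exact ⟨F + G, rfl⟩
  smul_mem' := by
    rintro c _ ⟨F, rfl⟩
    exact ⟨c • F, rfl⟩

theorem IsML.nface {n : ℕ} {φ : Cochain A n} (hφ : IsML φ) (i : ℕ) :
    IsML (fun a => φ (nface i a) : Cochain A (n + 1)) := by
  refine hφ.comp _ fun a ⟨k, hk⟩ => ?_
  by_cases hi : i ≤ n
  · rcases lt_trichotomy k i with h | rfl | h
    · refine ⟨⟨k, by omega⟩, LinearMap.id, fun x => ?_⟩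
      funext ⟨l, hl⟩
      simp only [nface_mk, Function.update_apply, Fin.mk.injEq, LinearMap.id_apply]
      grind
    · refine ⟨⟨k, by omega⟩, LinearMap.mulRight ℂ (a ⟨k + 1, by omega⟩), fun x => ?_⟩
      funext ⟨l, hl⟩
      simp only [nface_mk, Function.update_apply, Fin.mk.injEq, LinearMap.mulRight_apply]
      grind
    · rcases eq_or_ne k (i + 1) with rfl | h'
      · refine ⟨⟨i, by omega⟩, LinearMap.mulLeft ℂ (a ⟨i, by omega⟩), fun x => ?_⟩
        funext ⟨l, hl⟩
        simp only [nface_mk, Function.update_apply, Fin.mk.injEq, LinearMap.mulLeft_apply]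
        grind
      · refine ⟨⟨k - 1, by omega⟩, LinearMap.id, fun x => ?_⟩
        funext ⟨l, hl⟩
        simp only [nface_mk, Function.update_apply, Fin.mk.injEq, LinearMap.id_apply]
        grind
  · rcases eq_or_ne k 0 with rfl | h
    · refine ⟨⟨0, by omega⟩, LinearMap.mulLeft ℂ (a ⟨n + 1, by omega⟩), fun x => ?_⟩
      funext ⟨l, hl⟩
      simp only [nface_mk, Function.update_apply, Fin.mk.injEq, LinearMap.mulLeft_apply]
      grind
    · rcases eq_or_ne k (n + 1) with rfl | h'
      · refine ⟨⟨0, by omega⟩, LinearMap.mulRight ℂ (a ⟨0, by omega⟩), fun x => ?_⟩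
        funext ⟨l, hl⟩
        simp only [nface_mk, Function.update_apply, Fin.mk.injEq, LinearMap.mulRight_apply]
        grind
      · refine ⟨⟨k, by omega⟩, LinearMap.id, fun x => ?_⟩
        funext ⟨l, hl⟩
        simp only [nface_mk, Function.update_apply, Fin.mk.injEq, LinearMap.id_apply]
        grind

theorem IsML.smul {n : ℕ} {φ : Cochain A n} (hφ : IsML φ) (c : ℂ) : IsML (c • φ) :=
  (multilinearCochains A n).smul_mem c hφ

theorem IsML.add {n : ℕ} {φ ψ : Cochain A n} (hφ : IsML φ) (hψ : IsML ψ) : IsML (φ + ψ) :=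
  (multilinearCochains A n).add_mem hφ hψ

theorem IsML.neg {n : ℕ} {φ : Cochain A n} (hφ : IsML φ) : IsML (-φ) :=
  (multilinearCochains A n).neg_mem hφ

theorem IsML.sub {n : ℕ} {φ ψ : Cochain A n} (hφ : IsML φ) (hψ : IsML ψ) : IsML (φ - ψ) :=
  (multilinearCochains A n).sub_mem hφ hψ

theorem IsML.zero {n : ℕ} : IsML (0 : Cochain A n) :=
  (multilinearCochains A n).zero_mem

theorem IsML.lam {n : ℕ} {φ : Cochain A n} (hφ : IsML φ) : IsML (lam φ) := by
  refine (hφ.comp rot fun a k => ⟨k + 1, LinearMap.id, fun x => ?_⟩).smul ((-1) ^ n)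
  funext l
  simp [rot, Function.update_apply, sub_eq_iff_eq_add]

theorem IsML.lamL_pow {n : ℕ} {φ : Cochain A n} (hφ : IsML φ) (k : ℕ) :
    IsML ((lamL n ^ k) φ) := by
  rw [lamL_pow_apply]
  induction k with
  | zero => exact hφ
  | succ k ih => rw [Function.iterate_succ_apply']; exact ih.lam

theorem IsML.dL {n : ℕ} {φ : Cochain A n} (hφ : IsML φ) : IsML (dL n φ) := hφ.sub hφ.lam

theorem IsML.NL {n : ℕ} {φ : Cochain A n} (hφ : IsML φ) : IsML (NL n φ) := by
  rw [NCG.NL, LinearMap.sum_apply]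
  exact (multilinearCochains A n).sum_mem fun k _ => hφ.lamL_pow k

theorem IsML.theta {n : ℕ} {φ : Cochain A n} (hφ : IsML φ) : IsML (theta n φ) := by
  rw [NCG.theta, LinearMap.smul_apply, LinearMap.sum_apply]
  refine IsML.smul ((multilinearCochains A n).sum_mem fun k _ => ?_) _
  rw [LinearMap.sum_apply]
  exact (multilinearCochains A n).sum_mem fun j _ => hφ.lamL_pow j

theorem IsML.coface {n : ℕ} {φ : Cochain A n} (hφ : IsML φ) (i : ℕ) : IsML (coface i φ) :=
  (hφ.nface i).smul _

theorem IsML.bPL {n : ℕ} {φ : Cochain A n} (hφ : IsML φ) : IsML (bPL n φ) := by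
  rw [bPL_eq_sum]
  exact (multilinearCochains A (n + 1)).sum_mem fun i _ => hφ.coface i

theorem IsML.bHL {n : ℕ} {φ : Cochain A n} (hφ : IsML φ) : IsML (bHL n φ) := by
  rw [bHL_eq_sum]
  exact (multilinearCochains A (n + 1)).sum_mem fun i _ => hφ.coface i

theorem IsML.SL {n : ℕ} {φ : Cochain A (n + 1)} (hφ : IsML φ) : IsML (SL n φ) := by
  refine (hφ.comp (fun a => Fin.snoc a 1) fun a k =>
    ⟨k.castSucc, LinearMap.id, fun x => ?_⟩).smul ((-1) ^ n)
  exact Fin.snoc_update ..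

/-- The horizontal differential of the cyclic bicomplex from total degree `n - 1` to `n`. -/
def horiz (n m : ℕ) : Module.End ℂ (Cochain A m) :=
  if m % 2 = n % 2 then NL m else dL m

/-- The vertical differential of the cyclic bicomplex from total degree `n - 1` to `n`. -/
def vert (n m : ℕ) : Cochain A m →ₗ[ℂ] Cochain A (m + 1) :=
  if m % 2 = n % 2 then -bPL m else bHL m

/-- A contraction of the rows of the cyclic bicomplex. -/
def horizInv (n m : ℕ) : Module.End ℂ (Cochain A m) :=
  if m % 2 = n % 2 then ((m : ℂ) + 1)⁻¹ • 1 else theta m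

theorem vert_vert {n m : ℕ} (φ : Cochain A m) : vert (n + 1) (m + 1) (vert n m φ) = 0 := by
  unfold vert
  split_ifs
  · simp [bPL_bPL]
  · omega
  · omega
  · exact bHL_bHL φ

theorem horiz_vert {n m : ℕ} (φ : Cochain A m) :
    horiz (n + 1) (m + 1) (vert n m φ) = -vert (n + 1) m (horiz n m φ) := by
  unfold vert horiz
  split_ifs <;> first | omega | simp [NL_bPL, dL_bHL]

theorem horiz_horizInv {n m : ℕ} {φ : Cochain A m} (h : horiz (n + 1) m φ = 0) :
    horiz n m (horizInv n m φ) = φ := by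
  unfold horiz at h ⊢
  unfold horizInv
  split_ifs at h ⊢
  · omega
  · exact NL_inv_smul h
  · exact dL_theta h
  · omega

theorem IsML.vert {n m : ℕ} {φ : Cochain A m} (hφ : IsML φ) : IsML (vert n m φ) := by
  unfold NCG.vert
  split_ifs
  · exact hφ.bPL.neg
  · exact hφ.bHL

theorem IsML.horizInv {n m : ℕ} {φ : Cochain A m} (hφ : IsML φ) : IsML (horizInv n m φ) := by
  unfold NCG.horizInv
  split_ifs
  · exact hφ.smul _
  · exact hφ.theta

/-- The primitive of a cocycle in the cyclic bicomplex built from the row contractions. -/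
def rowPrimitive (n : ℕ) (c : ∀ m : ℕ, Cochain A m) : ∀ m : ℕ, Cochain A m
  | 0 => horizInv n 0 (c 0)
  | m + 1 => horizInv n (m + 1) (c (m + 1) - vert n m (rowPrimitive n c m))

theorem MLFam.rowPrimitive {c : ∀ m : ℕ, Cochain A m} (hc : MLFam c) (n : ℕ) :
    MLFam (rowPrimitive n c) := by
  intro m
  induction m with
  | zero => exact (hc 0).horizInv
  | succ m ih => exact ((hc (m + 1)).sub ih.vert).horizInv

theorem rowPrimitive_spec {n M : ℕ} {c : ∀ m : ℕ, Cochain A m} (h0 : horiz (n + 1) 0 (c 0) = 0)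
    (hc : ∀ m < M, horiz (n + 1) (m + 1) (c (m + 1)) + vert (n + 1) m (c m) = 0) :
    c 0 = horiz n 0 (rowPrimitive n c 0) ∧
      ∀ m < M, c (m + 1) =
        horiz n (m + 1) (rowPrimitive n c (m + 1)) + vert n m (rowPrimitive n c m) := by
  have e0 : c 0 = horiz n 0 (rowPrimitive n c 0) := (horiz_horizInv h0).symm
  have step : ∀ m < M,
      vert (n + 1) m (c m) = vert (n + 1) m (horiz n m (rowPrimitive n c m)) →
      c (m + 1) = horiz n (m + 1) (rowPrimitive n c (m + 1)) + vert n m (rowPrimitive n c m) := by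
    intro m hm h
    have : horiz (n + 1) (m + 1) (c (m + 1) - vert n m (rowPrimitive n c m)) = 0 := by
      rw [map_sub, horiz_vert, ← h, sub_neg_eq_add, hc m hm]
    rw [rowPrimitive, horiz_horizInv this]
    abel
  have key : ∀ m ≤ M,
      vert (n + 1) m (c m) = vert (n + 1) m (horiz n m (rowPrimitive n c m)) := by
    intro m hm
    induction m with
    | zero => rw [← e0]
    | succ m ih =>
      conv_lhs => rw [step m hm (ih (by omega))]
      rw [map_add, vert_vert, add_zero]
  exact ⟨e0, fun m hm => step m hm (key m hm.le)⟩

theorem dL_zero (φ : Cochain A 0) : dL 0 φ = 0 := by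
  rw [dL_eq_zero_iff]
  simpa using iterate_lam_eq φ

theorem totD_zero (x : ∀ m : ℕ, Cochain A m) : totD x 0 = NL 0 (SL 0 (dL 1 (x 1))) :=
  opB_eq _

theorem totD_succ (x : ∀ m : ℕ, Cochain A m) (m : ℕ) :
    totD x (m + 1) = bHL m (x m) + NL (m + 1) (SL (m + 1) (dL (m + 2) (x (m + 2)))) := by
  rw [← opB_eq]
  rfl

theorem InTot.eq_zero {N : ℤ} {x : ∀ m : ℕ, Cochain A m} (hx : InTot N x) {m : ℕ}
    (hm : N < m ∨ (m : ℤ) % 2 ≠ N % 2) : x m = 0 := by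
  by_contra h
  have := hx m h
  omega

theorem inclT_self (n : ℕ) (φ : Cochain A n) : inclT n φ n = φ := by simp [inclT]

theorem inclT_of_ne {n m : ℕ} (φ : Cochain A n) (h : m ≠ n) : inclT n φ m = 0 := by
  simp [inclT, h]

theorem dL_inclT {n : ℕ} {φ : Cochain A n} (hφ : dL n φ = 0) (m : ℕ) :
    dL m (inclT n φ m) = 0 := by
  rcases eq_or_ne m n with rfl | h
  · rw [inclT_self, hφ]
  · rw [inclT_of_ne φ h, map_zero]

theorem bPL_SL_of_bPL_eq_zero {n : ℕ} {φ : Cochain A (n + 1)} (h : bPL (n + 1) φ = 0) :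
    bPL n (SL n φ) = φ := by
  simpa [h] using SL_bPL_add φ

theorem SL_SL_of_bPL_eq_zero {φ : Cochain A 2} (h : bPL 2 φ = 0) : SL 0 (SL 1 φ) = 0 := by
  have h1 := SL_bPL_add (SL 1 φ)
  rw [bPL_SL_of_bPL_eq_zero h, add_eq_left] at h1
  rw [← SL_bPL_zero (SL 0 (SL 1 φ)), h1, map_zero]

theorem exists_cyclic_bicomplex_primitive {n : ℕ} {x : ∀ m : ℕ, Cochain A m} (hx : MLFam x)
    (hxn : InTot (n : ℤ) x) (h0 : totD x 0 = 0)
    (hD : ∀ m < n, totD x (m + 1) = 0) (hcyc : dL (n + 1) (bHL n (x n)) = 0) :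
    ∃ e : ∀ m : ℕ, Cochain A m, MLFam e ∧
      (0 % 2 = n % 2 → x 0 = NL 0 (e 0)) ∧
      (∀ m < n, (m + 1) % 2 = n % 2 → x (m + 1) = NL (m + 1) (e (m + 1)) + bHL m (e m)) ∧
      (0 % 2 ≠ n % 2 → SL 0 (dL 1 (x 1)) = dL 0 (e 0)) ∧
      (∀ m < n, (m + 1) % 2 ≠ n % 2 →
        SL (m + 1) (dL (m + 2) (x (m + 2))) = dL (m + 1) (e (m + 1)) - bPL m (e m)) := by
  have hz : ∀ m : ℕ, m % 2 ≠ n % 2 → x m = 0 := fun m hm => hxn.eq_zero (by omega)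
  have hb : ∀ m < n, dL (m + 1) (bHL m (x m)) = 0 := by
    intro m hm
    have := hD m hm
    rw [totD_succ, add_eq_zero_iff_eq_neg] at this
    rw [this, map_neg, dL_NL, neg_zero]
  let c : ∀ m : ℕ, Cochain A m := fun m => x m + SL m (dL (m + 1) (x (m + 1)))
  have c_of : ∀ m : ℕ, m % 2 = n % 2 → c m = x m := by
    intro m hm
    simp only [c]
    rw [hz (m + 1) (by omega)]
    simp
  have c_of_ne : ∀ m : ℕ, m % 2 ≠ n % 2 → c m = SL m (dL (m + 1) (x (m + 1))) := by
    intro m hm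
    simp only [c]
    rw [hz m hm, zero_add]
  have hc0 : horiz (n + 1) 0 (c 0) = 0 := by
    unfold horiz
    split_ifs with h
    · rw [c_of_ne 0 (by omega), ← totD_zero, h0]
    · exact dL_zero _
  have hc : ∀ m < n, horiz (n + 1) (m + 1) (c (m + 1)) + vert (n + 1) m (c m) = 0 := by
    intro m hm
    unfold horiz vert
    by_cases h : m % 2 = n % 2
    · rw [if_pos (by omega), if_neg (by omega), c_of m h, c_of_ne (m + 1) (by omega)]
      exact (add_comm _ _).trans ((totD_succ x m).symm.trans (hD m hm))
    · rw [if_neg (by omega), if_pos (by omega), c_of_ne m h, c_of (m + 1) (by omega),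
        LinearMap.neg_apply, add_neg_eq_zero, bPL_SL_of_bPL_eq_zero]
      rw [← dL_bHL]
      rcases eq_or_ne (m + 1) n with rfl | h'
      · exact hcyc
      · exact hb _ (by omega)
  obtain ⟨e0, e1⟩ := rowPrimitive_spec hc0 hc
  refine ⟨rowPrimitive n c, MLFam.rowPrimitive (fun m => (hx m).add (hx (m + 1)).dL.SL) n,
    fun h => ?_, fun m hm h => ?_, fun h => ?_, fun m hm h => ?_⟩
  · rwa [c_of 0 h, horiz, if_pos h] at e0
  · have := e1 m hm
    rwa [c_of _ h, horiz, if_pos h, vert, if_neg (by omega)] at this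
  · rwa [c_of_ne 0 h, horiz, if_neg h] at e0
  · have := e1 m hm
    rwa [c_of_ne _ h, horiz, if_neg h, vert, if_pos (by omega), LinearMap.neg_apply,
      ← sub_eq_add_neg] at this

/-- The cochain of the `(b,B)`-bicomplex obtained from one of the cyclic bicomplex. -/
def toTot (n : ℕ) (e : ∀ m : ℕ, Cochain A m) (m : ℕ) : Cochain A m :=
  if m % 2 = n % 2 then 0
  else e m + NL m (SL m (e (m + 1))) - NL m (SL m (SL (m + 1) (dL (m + 2) (e (m + 2)))))

theorem MLFam.toTot {e : ∀ m : ℕ, Cochain A m} (he : MLFam e) (n : ℕ) : MLFam (toTot n e) := by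
  intro m
  unfold NCG.toTot
  split_ifs
  · exact .zero
  · exact ((he m).add (he _).SL.NL).sub (he _).dL.SL.SL.NL

theorem dL_toTot {n m : ℕ} (e : ∀ m : ℕ, Cochain A m) (h : m % 2 ≠ n % 2) :
    dL m (toTot n e m) = dL m (e m) := by
  rw [toTot, if_neg h, map_sub, map_add, dL_NL, dL_NL, add_zero, sub_zero]

theorem inTot_toTot {n : ℕ} {e : ∀ m : ℕ, Cochain A m} (he : ∀ m, n ≤ m → e m = 0) :
    InTot ((n : ℤ) - 1) (toTot n e) := by
  intro m hm
  have h1 : m % 2 ≠ n % 2 := fun h => hm (by rw [toTot, if_pos h])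
  have h2 : m < n := by
    by_contra h
    refine hm ?_
    rw [toTot, he m (by omega), he (m + 1) (by omega), he (m + 2) (by omega)]
    simp
  omega

theorem totD_toTot {n : ℕ} {x e : ∀ m : ℕ, Cochain A m}
    (hx : ∀ m : ℕ, m % 2 ≠ n % 2 → x m = 0)
    (hN0 : 0 % 2 = n % 2 → x 0 = NL 0 (e 0))
    (hN : ∀ m, (m + 1) % 2 = n % 2 → x (m + 1) = NL (m + 1) (e (m + 1)) + bHL m (e m))
    (hd : ∀ m, (m + 1) % 2 ≠ n % 2 →
      SL (m + 1) (dL (m + 2) (x (m + 2))) = dL (m + 1) (e (m + 1)) - bPL m (e m)) :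
    x = totD (toTot n e) := by
  have hb : ∀ m, bPL m (dL m (x m)) = 0 := by
    intro m
    rw [← dL_bHL]
    by_cases h : m % 2 = n % 2
    · rcases m with _ | m
      · rw [hN0 h, ← NL_bPL, dL_NL]
      · rw [hN m h, map_add, bHL_bHL, add_zero, ← NL_bPL, dL_NL]
    · rw [hx m h, map_zero, map_zero]
  funext m
  rcases m with _ | m
  · rw [totD_zero]
    by_cases h : 0 % 2 = n % 2
    · rw [dL_toTot e (by omega), ← sub_add_cancel (dL 1 (e 1)) (bPL 0 (e 0)), ← hd 0 (by omega),
        map_add, SL_SL_of_bPL_eq_zero (hb 2), SL_bPL_zero, zero_add (e 0), hN0 h]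
    · rw [hx 0 h, toTot, if_pos (by omega)]
      simp
  · rw [totD_succ]
    by_cases h : (m + 1) % 2 = n % 2
    · have hd' := hd (m + 1) (by omega)
      rw [dL_toTot e (by omega), hN m h, toTot, if_neg (by omega), map_sub, map_add, ← NL_bPL,
        ← NL_bPL, ← sub_add_cancel (dL (m + 2) (e (m + 2))) (bPL (m + 1) (e (m + 1))), ← hd']
      have hw := bPL_SL_of_bPL_eq_zero (hb (m + 3))
      set w := SL (m + 2) (dL (m + 3) (x (m + 3))) with hwdef
      have hw0 : bPL (m + 1) (SL (m + 1) w) = 0 := by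
        have := SL_bPL_add w
        rwa [hw, ← hwdef, add_eq_left] at this
      have h1 := SL_bPL_add (SL (m + 1) w)
      have h2 := SL_bPL_add (e (m + 1))
      have h3 := SL_bPL_add (SL (m + 1) (bPL (m + 1) (e (m + 1))))
      rw [bPL_SL_of_bPL_eq_zero (bPL_bPL _)] at h3
      rw [hw0, map_zero, zero_add] at h1
      rw [add_eq_left] at h3
      simp only [map_add, h1, h3]
      nth_rw 1 [← h2]
      rw [map_add, map_zero]
      abel
    · rw [hx _ h, toTot, if_pos (by omega), toTot, if_pos (by omega)]
      simp

theorem totD_inclT {n : ℕ} {φ : Cochain A n} (hφ : lam φ = φ) :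
    totD (inclT n φ) = inclT (n + 1) (bH φ) := by
  have hd := dL_inclT (dL_eq_zero_iff.2 hφ)
  funext m
  rcases m with _ | m
  · rw [totD_zero, hd, inclT_of_ne _ (by omega)]
    simp
  · rw [totD_succ, hd, map_zero, map_zero, add_zero]
    rcases eq_or_ne m n with rfl | h
    · rw [inclT_self, inclT_self]
      rfl
    · rw [inclT_of_ne _ h, inclT_of_ne _ (by omega), map_zero]

theorem exists_cyclic_representative {n : ℕ} {x : ∀ m : ℕ, Cochain A m} (hx : MLFam x)
    (hxn : InTot (n : ℤ) x) (hD : totD x = 0) :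
    ∃ (φ : Cochain A n) (y : ∀ m : ℕ, Cochain A m),
      IsML φ ∧ lam φ = φ ∧ bH φ = 0 ∧ MLFam y ∧ InTot ((n : ℤ) - 1) y ∧
      x = inclT n φ + totD y := by
  have hbn : bHL n (x n) = 0 := by
    have := congrFun hD (n + 1)
    rwa [totD_succ, hxn.eq_zero (m := n + 2) (by omega), map_zero, map_zero, map_zero,
      add_zero] at this
  obtain ⟨e, he, hN0, hN, hd0, hd⟩ := exists_cyclic_bicomplex_primitive hx hxn
    (congrFun hD 0) (fun m _ => congrFun hD (m + 1)) (by rw [hbn, map_zero])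
  have hφ : dL n (NL n (e n)) = 0 := dL_NL _
  let e' : ∀ m : ℕ, Cochain A m := fun m => if m < n then e m else 0
  have e'_lt : ∀ m, m < n → e' m = e m := fun m h => if_pos h
  have e'_ge : ∀ m, n ≤ m → e' m = 0 := fun m h => if_neg (by omega)
  have hz : ∀ m : ℕ, n < m ∨ m % 2 ≠ n % 2 → x m = 0 := fun m hm => hxn.eq_zero (by omega)
  have key : x - inclT n (NL n (e n)) = totD (toTot n e') := by
    refine totD_toTot (fun m hm => ?_) (fun h => ?_) (fun m h => ?_) fun m h => ?_
    · rw [Pi.sub_apply, hz m (.inr hm), inclT_of_ne _ (by rintro rfl; exact hm rfl), sub_zero]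
    · rw [Pi.sub_apply, hN0 h]
      rcases Nat.eq_zero_or_pos n with rfl | hn
      · rw [inclT_self, e'_ge 0 le_rfl, sub_self, map_zero]
      · rw [inclT_of_ne _ (by omega), e'_lt 0 hn, sub_zero]
    · rw [Pi.sub_apply]
      rcases lt_trichotomy (m + 1) n with hm | rfl | hm
      · rw [hN m (by omega) h, inclT_of_ne _ (by omega), e'_lt _ hm, e'_lt m (by omega), sub_zero]
      · rw [hN m (by omega) h, inclT_self, e'_ge _ le_rfl, e'_lt m (by omega)]
        simp
      · rw [hz _ (.inl hm), inclT_of_ne _ (by omega), e'_ge _ (by omega), e'_ge m (by omega)]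
        simp
    · rw [Pi.sub_apply, map_sub, dL_inclT hφ, sub_zero]
      rcases lt_or_ge (m + 1) n with hm | hm
      · rw [hd m (by omega) h, e'_lt _ hm, e'_lt m (by omega)]
      · rw [hz _ (.inl (by omega)), e'_ge _ (by omega), e'_ge m (by omega)]
        simp
  refine ⟨NL n (e n), toTot n e', (he n).NL, dL_eq_zero_iff.1 hφ, ?_, MLFam.toTot (fun m => ?_) n,
    inTot_toTot e'_ge, ?_⟩
  · change bHL n _ = 0
    rcases n with _ | n
    · rw [← hN0 rfl, hbn]
    · rw [hN n (by omega) rfl, map_add, bHL_bHL, add_zero] at hbn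
      exact hbn
  · simp only [e']
    split_ifs
    · exact he m
    · exact .zero
  · rw [← key]
    abel

theorem exists_cyclic_primitive {n : ℕ} {φ : Cochain A (n + 1)} (hφ : lam φ = φ)
    {y : ∀ m : ℕ, Cochain A m} (hy : MLFam y) (hyn : InTot (n : ℤ) y)
    (h : inclT (n + 1) φ = totD y) :
    ∃ ψ : Cochain A n, IsML ψ ∧ lam ψ = ψ ∧ bH ψ = φ := by
  have hbn : bHL n (y n) = φ := by
    have := congrFun h (n + 1)
    rwa [totD_succ, hyn.eq_zero (m := n + 2) (by omega), map_zero, map_zero, map_zero,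
      add_zero, inclT_self, eq_comm] at this
  obtain ⟨e, he, hN0, hN, -, -⟩ := exists_cyclic_bicomplex_primitive hy hyn
    (by rw [← h, inclT_of_ne _ (by omega)]) (fun m hm => by rw [← h, inclT_of_ne _ (by omega)])
    (by rw [hbn, dL_eq_zero_iff, hφ])
  refine ⟨NL n (e n), (he n).NL, dL_eq_zero_iff.1 (dL_NL _), ?_⟩
  change bHL n _ = φ
  rcases n with _ | n
  · rw [← hN0 rfl, hbn]
  · rwa [hN n (by omega) rfl, map_add, bHL_bHL, add_zero] at hbn

/-- Theorem (Connes): the map `C_λⁿ(A) → Totⁿ 𝓑(A)`, `φ ↦ (0,…,0,φ)` (the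
component in `Cⁿ(A)` being `φ`) is a quasi-isomorphism from the cyclic complex
`(C_λ^*(A), b)` to the total complex `(Tot 𝓑(A), b + B)`: it is a chain map
(first conjunct) inducing an isomorphism on cohomology in every degree
(second conjunct: surjectivity; third and fourth: injectivity in degree `0`
and in degrees `≥ 1`). -/
theorem cyclic_complex_to_bB_bicomplex_quasi_iso (A : Type) [Ring A] [Algebra ℂ A] :
    -- chain map property
    (∀ (n : ℕ) (φ : Cochain A n), IsML φ → lam φ = φ →
      totD (inclT n φ) = inclT (n + 1) (bH φ)) ∧
    -- surjectivity on cohomology in degree n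
    (∀ (n : ℕ) (x : ∀ m : ℕ, Cochain A m), MLFam x → InTot (n : ℤ) x → totD x = 0 →
      ∃ (φ : Cochain A n) (y : ∀ m : ℕ, Cochain A m),
        IsML φ ∧ lam φ = φ ∧ bH φ = 0 ∧ MLFam y ∧ InTot ((n : ℤ) - 1) y ∧
        x = inclT n φ + totD y) ∧
    -- injectivity on cohomology in degree 0
    (∀ φ : Cochain A 0, IsML φ → lam φ = φ → bH φ = 0 →
      (∃ y : ∀ m : ℕ, Cochain A m, MLFam y ∧ InTot (-1 : ℤ) y ∧ inclT 0 φ = totD y) →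
      φ = 0) ∧
    -- injectivity on cohomology in degree n + 1
    (∀ (n : ℕ) (φ : Cochain A (n + 1)), IsML φ → lam φ = φ → bH φ = 0 →
      (∃ y : ∀ m : ℕ, Cochain A m, MLFam y ∧ InTot (n : ℤ) y ∧ inclT (n + 1) φ = totD y) →
      ∃ ψ : Cochain A n, IsML ψ ∧ lam ψ = ψ ∧ bH ψ = φ) := by
  refine ⟨fun n φ _ hφ => totD_inclT hφ,
    fun n x hx hxn hD => exists_cyclic_representative hx hxn hD, ?_,
    fun n φ _ hφ _ ⟨y, hy, hyn, h⟩ => exists_cyclic_primitive hφ hy hyn h⟩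
  rintro φ - - - ⟨y, -, hyn, h⟩
  have := congrFun h 0
  rwa [inclT_self, totD_zero, hyn.eq_zero (m := 1) (by omega), map_zero, map_zero, map_zero] at this

end NCG
end
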